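/- arXiv:1911.06081 — 6 statements merged into one kernel-verified Lean document; each statement's English description precedes it below -/
import Mathlib

section
/- Let ε₀ > 0, let nx, ny ∈ ℕ, and let B11, B12, B21, B22, A11, A22 be real matrices of sizes nx×nx, nx×ny, ny×nx, ny×ny, nx×nx, ny×ny respectively, with B22 invertible. Suppose that for every ε ∈ (0, ε₀) the real matrices K11ᵉ (symmetric), K12ᵉ, K21ᵉ = (K12ᵉ)ᵀ, K22ᵉ (symmetric) satisfy the block Lyapunov equations (L1) B11·K11ᵉ + B12·K21ᵉ + K11ᵉ·B11ᵀ + K12ᵉ·B12ᵀ = −A11·A11ᵀ, (L2) B11·K12ᵉ + B12·K22ᵉ + ε⁻¹·(K11ᵉ·B21ᵀ + K12ᵉ·B22ᵀ) = 0, (L3) B21·K12ᵉ + B22·K22ᵉ + K21ᵉ·B21ᵀ + K22ᵉ·B22ᵀ = −A22·A22ᵀ, and suppose that K11ᵉ → K11⁰, K12ᵉ → K12⁰, K22ᵉ → K22⁰ entrywise as ε → 0⁺. Then the limit K11⁰ satisfies the reduced Lyapunov equation (B11 − B12·B22⁻¹·B21)·K11⁰ + K11⁰·(B11 − B12·B22⁻¹·B21)ᵀ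 = −A11·A11ᵀ. -/
open Matrix Filter Topology

/-- The ε → 0⁺ limit K11⁰ of the slow-block covariance satisfies the
reduced Lyapunov equation
(B11 − B12·B22⁻¹·B21)·K11⁰ + K11⁰·(B11 − B12·B22⁻¹·B21)ᵀ = −A11·A11ᵀ. -/
theorem limit_reduced_lyapunov {nx ny : ℕ} (ε₀ : ℝ) (hε₀ : 0 < ε₀)
    (B11 A11 : Matrix (Fin nx) (Fin nx) ℝ) (B12 : Matrix (Fin nx) (Fin ny) ℝ)
    (B21 : Matrix (Fin ny) (Fin nx) ℝ) (B22 A22 : Matrix (Fin ny) (Fin ny) ℝ)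
    (hB22 : IsUnit B22.det)
    (K11 : ℝ → Matrix (Fin nx) (Fin nx) ℝ) (K12 : ℝ → Matrix (Fin nx) (Fin ny) ℝ)
    (K21 : ℝ → Matrix (Fin ny) (Fin nx) ℝ) (K22 : ℝ → Matrix (Fin ny) (Fin ny) ℝ)
    (hK11sym : ∀ ε ∈ Set.Ioo (0 : ℝ) ε₀, (K11 ε).IsSymm)
    (hK22sym : ∀ ε ∈ Set.Ioo (0 : ℝ) ε₀, (K22 ε).IsSymm)
    (hK21 : ∀ ε ∈ Set.Ioo (0 : ℝ) ε₀, K21 ε = (K12 ε)ᵀ)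
    (hL1 : ∀ ε ∈ Set.Ioo (0 : ℝ) ε₀,
      B11 * K11 ε + B12 * K21 ε + K11 ε * B11ᵀ + K12 ε * B12ᵀ = -(A11 * A11ᵀ))
    (hL2 : ∀ ε ∈ Set.Ioo (0 : ℝ) ε₀,
      B11 * K12 ε + B12 * K22 ε + ε⁻¹ • (K11 ε * B21ᵀ + K12 ε * B22ᵀ) = 0)
    (hL3 : ∀ ε ∈ Set.Ioo (0 : ℝ) ε₀,
      B21 * K12 ε + B22 * K22 ε + K21 ε * B21ᵀ + K22 ε * B22ᵀ = -(A22 * A22ᵀ))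
    (K11₀ : Matrix (Fin nx) (Fin nx) ℝ) (K12₀ : Matrix (Fin nx) (Fin ny) ℝ)
    (K22₀ : Matrix (Fin ny) (Fin ny) ℝ)
    (h11 : Tendsto K11 (nhdsWithin 0 (Set.Ioi 0)) (nhds K11₀))
    (h12 : Tendsto K12 (nhdsWithin 0 (Set.Ioi 0)) (nhds K12₀))
    (h22 : Tendsto K22 (nhdsWithin 0 (Set.Ioi 0)) (nhds K22₀)) :
    (B11 - B12 * B22⁻¹ * B21) * K11₀ + K11₀ * (B11 - B12 * B22⁻¹ * B21)ᵀ
      = -(A11 * A11ᵀ) := by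
  have hsub : ∀ᶠ ε in 𝓝[>] (0 : ℝ), ε ∈ Set.Ioo (0 : ℝ) ε₀ := Ioo_mem_nhdsGT hε₀
  have hid : Tendsto (fun ε : ℝ => ε) (𝓝[>] 0) (𝓝 0) := nhdsWithin_le_nhds
  have h12t : Tendsto (fun ε => (K12 ε)ᵀ) (𝓝[>] 0) (𝓝 K12₀ᵀ) :=
    (continuous_id.matrix_transpose.tendsto _).comp h12
  have h11t : Tendsto (fun ε => (K11 ε)ᵀ) (𝓝[>] 0) (𝓝 K11₀ᵀ) :=
    (continuous_id.matrix_transpose.tendsto _).comp h11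
  have hsym : K11₀ᵀ = K11₀ :=
    tendsto_nhds_unique_of_eventuallyEq h11t h11 (hsub.mono fun ε hε => hK11sym ε hε)
  have slow_eq : B11 * K11₀ + B12 * K12₀ᵀ + K11₀ * B11ᵀ + K12₀ * B12ᵀ = -(A11 * A11ᵀ) := by
    have hlim := ((((tendsto_const_nhds (x := B11)).mul h11).add
      (((continuous_const (y := B12)).matrix_mul
        continuous_id.matrix_transpose).tendsto K12₀ |>.comp h12)).add
      (h11.mul (tendsto_const_nhds (x := B11ᵀ)))).add
      ((continuous_id.matrix_mul (continuous_const (y := B12ᵀ))).tendsto K12₀ |>.comp h12)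
    refine tendsto_nhds_unique_of_eventuallyEq hlim tendsto_const_nhds (hsub.mono fun ε hε => ?_)
    simpa [hK21 ε hε] using hL1 ε hε
  have cross_eq : K11₀ * B21ᵀ + K12₀ * B22ᵀ = 0 := by
    have hfast : Tendsto (fun ε => K11 ε * B21ᵀ + K12 ε * B22ᵀ) (𝓝[>] 0)
        (𝓝 (K11₀ * B21ᵀ + K12₀ * B22ᵀ)) :=
      ((continuous_id.matrix_mul (continuous_const (y := B21ᵀ))).tendsto K11₀ |>.comp h11).add
        ((continuous_id.matrix_mul (continuous_const (y := B22ᵀ))).tendsto K12₀ |>.comp h12)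
    have hslow : Tendsto (fun ε => B11 * K12 ε + B12 * K22 ε) (𝓝[>] 0)
        (𝓝 (B11 * K12₀ + B12 * K22₀)) :=
      (((continuous_const (y := B11)).matrix_mul continuous_id).tendsto K12₀ |>.comp h12).add
        (((continuous_const (y := B12)).matrix_mul continuous_id).tendsto K22₀ |>.comp h22)
    have hlim := (hid.smul hslow).add hfast
    rw [zero_smul, zero_add] at hlim
    refine tendsto_nhds_unique_of_eventuallyEq hlim tendsto_const_nhds (hsub.mono fun ε hε => ?_)
    have h := congrArg (ε • ·) (hL2 ε hε)
    simpa only [smul_add ε (_ + _) (ε⁻¹ • _), smul_inv_smul₀ hε.1.ne', smul_zero] using h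
  have hK12 : K12₀ = -(K11₀ * B21ᵀ * B22⁻¹ᵀ) := by
    have hinv : B22ᵀ * B22⁻¹ᵀ = 1 := by
      rw [← transpose_mul, nonsing_inv_mul _ hB22, transpose_one]
    calc K12₀ = K12₀ * (B22ᵀ * B22⁻¹ᵀ) := by rw [hinv, Matrix.mul_one]
      _ = -(K11₀ * B21ᵀ * B22⁻¹ᵀ) := by
        rw [← Matrix.mul_assoc, eq_neg_of_add_eq_zero_right cross_eq, Matrix.neg_mul]
  rw [← slow_eq, hK12]
  simp only [transpose_sub, transpose_mul, transpose_neg, transpose_transpose, hsym,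
    Matrix.sub_mul, Matrix.mul_sub, Matrix.neg_mul, Matrix.mul_neg, Matrix.mul_assoc]
  abel
end

section
/- Let nx, ny ∈ ℕ, let K11 (nx×nx, symmetric, invertible), K12 (nx×ny), K21 = K12ᵀ (ny×nx), K22 (ny×ny) be real matrices, and let B21 (ny×nx), B22 (ny×ny, invertible), A22 (ny×ny) be real matrices. Assume K12 = −K11·B21ᵀ·(B22ᵀ)⁻¹ and B21·K12 + B22·K22 + K21·B21ᵀ + K22·B22ᵀ = −A22·A22ᵀ. Then the Schur complement Σ := K22 − K21·K11⁻¹·K12 satisfies the Lyapunov equation B22·Σ + Σ·B22ᵀ = −A22·A22ᵀ. -/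
open Matrix

/-- If K12 = −K11·B21ᵀ·(B22ᵀ)⁻¹ and the fast-block Lyapunov relation
B21·K12 + B22·K22 + K21·B21ᵀ + K22·B22ᵀ = −A22·A22ᵀ holds, then the Schur complement
Σ = K22 − K21·K11⁻¹·K12 satisfies B22·Σ + Σ·B22ᵀ = −A22·A22ᵀ. -/
theorem schur_complement_lyapunov {nx ny : ℕ}
    (K11 : Matrix (Fin nx) (Fin nx) ℝ) (K12 : Matrix (Fin nx) (Fin ny) ℝ)
    (K21 : Matrix (Fin ny) (Fin nx) ℝ) (K22 : Matrix (Fin ny) (Fin ny) ℝ)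
    (B21 : Matrix (Fin ny) (Fin nx) ℝ) (B22 A22 : Matrix (Fin ny) (Fin ny) ℝ)
    (hK11sym : K11.IsSymm) (hK11 : IsUnit K11.det) (hB22 : IsUnit B22.det)
    (hK21 : K21 = K12ᵀ)
    (hK12 : K12 = -(K11 * B21ᵀ * (B22ᵀ)⁻¹))
    (hLyap : B21 * K12 + B22 * K22 + K21 * B21ᵀ + K22 * B22ᵀ = -(A22 * A22ᵀ)) :
    B22 * (K22 - K21 * K11⁻¹ * K12) + (K22 - K21 * K11⁻¹ * K12) * B22ᵀ
      = -(A22 * A22ᵀ) := by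
  have h₁ : K12 * B22ᵀ = -(K11 * B21ᵀ) := by
    rw [hK12, Matrix.neg_mul,
      Matrix.nonsing_inv_mul_cancel_right _ _ (B22.isUnit_det_transpose hB22)]
  have h₂ : B22 * K21 = -(B21 * K11) := by
    simpa [hK21, Matrix.transpose_mul, hK11sym.eq] using congrArg Matrix.transpose h₁
  have h₃ : B22 * (K21 * K11⁻¹ * K12) = -(B21 * K12) := by
    rw [← Matrix.mul_assoc, ← Matrix.mul_assoc, h₂, Matrix.neg_mul,
      Matrix.mul_nonsing_inv_cancel_right _ _ hK11, Matrix.neg_mul]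
  have h₄ : K21 * K11⁻¹ * K12 * B22ᵀ = -(K21 * B21ᵀ) := by
    rw [Matrix.mul_assoc, h₁, Matrix.mul_neg, Matrix.mul_assoc,
      Matrix.nonsing_inv_mul_cancel_left _ _ hK11]
  rw [Matrix.mul_sub, Matrix.sub_mul, h₃, h₄, ← hLyap]
  abel
end

section
/- Let ε₀ > 0, let nx, ny ∈ ℕ, and let B11, B12, B21, B22, A11, A22 be real matrices of sizes nx×nx, nx×ny, ny×nx, ny×ny, nx×nx, ny×ny respectively, with B22 invertible. Suppose that for every ε ∈ (0, ε₀) the real matrices K11ᵉ (symmetric, invertible), K12ᵉ, K21ᵉ = (K12ᵉ)ᵀ, K22ᵉ (symmetric) satisfy the block Lyapunov equations (L1) B11·K11ᵉ + B12·K21ᵉ + K11ᵉ·B11ᵀ + K12ᵉ·B12ᵀ = −A11·A11ᵀ, (L2) B11·K12ᵉ + B12·K22ᵉ + ε⁻¹·(K11ᵉ·B21ᵀ + K12ᵉ·B22ᵀ) = 0, (L3) B21·K12ᵉ + B22·K22ᵉ + K21ᵉ·B21ᵀ + K22ᵉ·B22ᵀ = −A22·A22ᵀ, and suppose that K11ᵉ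 → K11⁰, K12ᵉ → K12⁰, K22ᵉ → K22⁰ entrywise as ε → 0⁺ with K11⁰ invertible. Then the conditional-mean matrix converges: K21ᵉ·(K11ᵉ)⁻¹ → −B22⁻¹·B21 as ε → 0⁺. -/
open Matrix Filter Topology

theorem Matrix.tendsto_inv {α n : Type*} [Fintype n] [DecidableEq n] {l : Filter α}
    {K : α → Matrix n n ℝ} {K₀ : Matrix n n ℝ} (h : Tendsto K l (𝓝 K₀)) (hK₀ : IsUnit K₀.det) :
    Tendsto (fun a => (K a)⁻¹) l (𝓝 K₀⁻¹) := by
  have hinv : ContinuousAt Ring.inverse K₀.det := by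
    rw [Ring.inverse_eq_inv']
    exact continuousAt_inv₀ hK₀.ne_zero
  exact (continuousAt_matrix_inv K₀ hinv).tendsto.comp h

/-- Convergence of the conditional-mean matrix:
K21ᵉ·(K11ᵉ)⁻¹ → −B22⁻¹·B21 as ε → 0⁺. -/
theorem conditional_mean_limit {nx ny : ℕ} (ε₀ : ℝ) (hε₀ : 0 < ε₀)
    (B11 A11 : Matrix (Fin nx) (Fin nx) ℝ) (B12 : Matrix (Fin nx) (Fin ny) ℝ)
    (B21 : Matrix (Fin ny) (Fin nx) ℝ) (B22 A22 : Matrix (Fin ny) (Fin ny) ℝ)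
    (hB22 : IsUnit B22.det)
    (K11 : ℝ → Matrix (Fin nx) (Fin nx) ℝ) (K12 : ℝ → Matrix (Fin nx) (Fin ny) ℝ)
    (K21 : ℝ → Matrix (Fin ny) (Fin nx) ℝ) (K22 : ℝ → Matrix (Fin ny) (Fin ny) ℝ)
    (hK11sym : ∀ ε ∈ Set.Ioo (0 : ℝ) ε₀, (K11 ε).IsSymm)
    (hK11inv : ∀ ε ∈ Set.Ioo (0 : ℝ) ε₀, IsUnit (K11 ε).det)
    (hK22sym : ∀ ε ∈ Set.Ioo (0 : ℝ) ε₀, (K22 ε).IsSymm)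
    (hK21 : ∀ ε ∈ Set.Ioo (0 : ℝ) ε₀, K21 ε = (K12 ε)ᵀ)
    (hL1 : ∀ ε ∈ Set.Ioo (0 : ℝ) ε₀,
      B11 * K11 ε + B12 * K21 ε + K11 ε * B11ᵀ + K12 ε * B12ᵀ = -(A11 * A11ᵀ))
    (hL2 : ∀ ε ∈ Set.Ioo (0 : ℝ) ε₀,
      B11 * K12 ε + B12 * K22 ε + ε⁻¹ • (K11 ε * B21ᵀ + K12 ε * B22ᵀ) = 0)
    (hL3 : ∀ ε ∈ Set.Ioo (0 : ℝ) ε₀,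
      B21 * K12 ε + B22 * K22 ε + K21 ε * B21ᵀ + K22 ε * B22ᵀ = -(A22 * A22ᵀ))
    (K11₀ : Matrix (Fin nx) (Fin nx) ℝ) (K12₀ : Matrix (Fin nx) (Fin ny) ℝ)
    (K22₀ : Matrix (Fin ny) (Fin ny) ℝ)
    (h11 : Tendsto K11 (nhdsWithin 0 (Set.Ioi 0)) (nhds K11₀))
    (h12 : Tendsto K12 (nhdsWithin 0 (Set.Ioi 0)) (nhds K12₀))
    (h22 : Tendsto K22 (nhdsWithin 0 (Set.Ioi 0)) (nhds K22₀))
    (hK11₀ : IsUnit K11₀.det) :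
    Tendsto (fun ε => K21 ε * (K11 ε)⁻¹) (nhdsWithin 0 (Set.Ioi 0))
      (nhds (-(B22⁻¹ * B21))) := by
  have hIoo : ∀ᶠ ε in 𝓝[>] (0 : ℝ), ε ∈ Set.Ioo (0 : ℝ) ε₀ := Ioo_mem_nhdsGT hε₀
  have hsymm : K11₀ᵀ = K11₀ := by
    refine tendsto_nhds_unique_of_eventuallyEq
      ((continuous_id.matrix_transpose.tendsto K11₀).comp h11) h11 ?_
    filter_upwards [hIoo] with ε hε using hK11sym ε hε
  have hbalance : K11₀ * B21ᵀ + K12₀ * B22ᵀ = 0 := by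
    have hlim : Tendsto (fun ε => K11 ε * B21ᵀ + K12 ε * B22ᵀ) (𝓝[>] 0)
        (𝓝 (K11₀ * B21ᵀ + K12₀ * B22ᵀ)) :=
      (((continuous_id.matrix_mul continuous_const).tendsto K11₀).comp h11).add
        (((continuous_id.matrix_mul continuous_const).tendsto K12₀).comp h12)
    have hε : Tendsto (fun ε : ℝ => -ε) (𝓝[>] 0) (𝓝 0) := by
      simpa using (tendsto_nhdsWithin_of_tendsto_nhds (tendsto_id (x := 𝓝 (0 : ℝ)))).neg
    have hslow : Tendsto (fun ε => -ε • (B11 * K12 ε + B12 * K22 ε)) (𝓝[>] 0) (𝓝 0) := by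
      simpa using hε.smul ((((continuous_const (y := B11)).matrix_mul continuous_id).tendsto K12₀).comp h12
          |>.add ((((continuous_const (y := B12)).matrix_mul continuous_id).tendsto K22₀).comp h22))
    refine tendsto_nhds_unique_of_eventuallyEq hlim hslow ?_
    filter_upwards [hIoo] with ε hε
    rw [eq_neg_of_add_eq_zero_left (hL2 ε hε), smul_neg, neg_smul, neg_neg,
      smul_inv_smul₀ hε.1.ne']
  have hmean : K12₀ᵀ * K11₀⁻¹ = -(B22⁻¹ * B21) := by
    have h : B21 * K11₀ + B22 * K12₀ᵀ = 0 := by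
      simpa [hsymm] using congrArg transpose hbalance
    have h' : K12₀ᵀ = -(B22⁻¹ * B21) * K11₀ := by
      rw [← nonsing_inv_mul_cancel_left B22 K12₀ᵀ hB22, eq_neg_of_add_eq_zero_right h,
        Matrix.mul_neg, Matrix.neg_mul, Matrix.mul_assoc]
    rw [h', mul_nonsing_inv_cancel_right _ _ hK11₀]
  have h21 : Tendsto K21 (𝓝[>] 0) (𝓝 K12₀ᵀ) := by
    refine ((continuous_id.matrix_transpose.tendsto K12₀).comp h12).congr' ?_
    filter_upwards [hIoo] with ε hε using (hK21 ε hε).symm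
  rw [← hmean]
  exact (Continuous.matrix_mul continuous_fst continuous_snd).tendsto (K12₀ᵀ, K11₀⁻¹) |>.comp
    (h21.prodMk_nhds (Matrix.tendsto_inv h11 hK11₀))
end

section
/- Let ε₀ > 0, let nx, ny ∈ ℕ, and let B11, B12, B21, B22, A11, A22 be real matrices of sizes nx×nx, nx×ny, ny×nx, ny×ny, nx×nx, ny×ny respectively, with B22 invertible. Suppose that for every ε ∈ (0, ε₀) the real matrices K11ᵉ (symmetric, invertible), K12ᵉ, K21ᵉ = (K12ᵉ)ᵀ, K22ᵉ (symmetric) satisfy the block Lyapunov equations (L1) B11·K11ᵉ + B12·K21ᵉ + K11ᵉ·B11ᵀ + K12ᵉ·B12ᵀ = −A11·A11ᵀ, (L2) B11·K12ᵉ + B12·K22ᵉ + ε⁻¹·(K11ᵉ·B21ᵀ + K12ᵉ·B22ᵀ) = 0, (L3) B21·K12ᵉ + B22·K22ᵉ + K21ᵉ·B21ᵀ + K22ᵉ·B22ᵀ = −A22·A22ᵀ, and suppose that K11ᵉ → K11⁰, K12ᵉ → K12⁰, K22ᵉ → K22⁰ entrywise as ε → 0⁺ with K11⁰ invertible. Then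 the conditional covariance Kᶜ(ε) := K22ᵉ − K21ᵉ·(K11ᵉ)⁻¹·K12ᵉ converges as ε → 0⁺ to a matrix Σ satisfying the Lyapunov equation B22·Σ + Σ·B22ᵀ = −A22·A22ᵀ. -/
open Matrix Filter Topology

theorem Matrix.tendsto_inv_of_isUnit_det {α n : Type*} [Fintype n] [DecidableEq n]
    {l : Filter α} {f : α → Matrix n n ℝ} {A : Matrix n n ℝ}
    (hf : Tendsto f l (𝓝 A)) (hA : IsUnit A.det) :
    Tendsto (fun a => (f a)⁻¹) l (𝓝 A⁻¹) := by
  have hdet : Tendsto (fun a => (f a).det) l (𝓝 A.det) :=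
    (Continuous.matrix_det continuous_id).continuousAt.tendsto.comp hf
  have hadj : Tendsto (fun a => (f a).adjugate) l (𝓝 A.adjugate) :=
    (Continuous.matrix_adjugate continuous_id).continuousAt.tendsto.comp hf
  simpa only [Matrix.inv_def, Ring.inverse_eq_inv'] using (hdet.inv₀ hA.ne_zero).smul hadj

/-- Block elimination: the Schur complement of a block covariance whose off-diagonal block
satisfies `P * B₂₁ᵀ + Q * B₂₂ᵀ = 0` solves the Lyapunov equation of the second block. -/
theorem Matrix.schur_complement_lyapunov {m n R : Type*} [Fintype m] [Fintype n] [DecidableEq m]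
    [CommRing R] {B₂₁ : Matrix n m R} {B₂₂ D : Matrix n n R} {P : Matrix m m R}
    {Q : Matrix m n R} {T : Matrix n n R} (hP : P.IsSymm) (hdet : IsUnit P.det)
    (hoff : P * B₂₁ᵀ + Q * B₂₂ᵀ = 0)
    (hdiag : B₂₁ * Q + B₂₂ * T + Qᵀ * B₂₁ᵀ + T * B₂₂ᵀ = D) :
    B₂₂ * (T - Qᵀ * P⁻¹ * Q) + (T - Qᵀ * P⁻¹ * Q) * B₂₂ᵀ = D := by
  have hright : Qᵀ * P⁻¹ * Q * B₂₂ᵀ = -(Qᵀ * B₂₁ᵀ) := by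
    rw [Matrix.mul_assoc _ Q, eq_neg_of_add_eq_zero_right hoff, Matrix.mul_neg,
      Matrix.mul_assoc, Matrix.nonsing_inv_mul_cancel_left _ _ hdet]
  have hleft : B₂₂ * (Qᵀ * P⁻¹ * Q) = -(B₂₁ * Q) := by
    have h := congrArg Matrix.transpose hright
    simpa [Matrix.transpose_mul, Matrix.transpose_nonsing_inv, hP.eq, Matrix.mul_assoc] using h
  rw [Matrix.mul_sub, Matrix.sub_mul, hleft, hright, ← hdiag]
  abel

/-- Convergence of the conditional covariance
Kᶜ(ε) = K22ᵉ − K21ᵉ·(K11ᵉ)⁻¹·K12ᵉ as ε → 0⁺ to a matrix Σ satisfying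
B22·Σ + Σ·B22ᵀ = −A22·A22ᵀ. -/
theorem conditional_covariance_limit {nx ny : ℕ} (ε₀ : ℝ) (hε₀ : 0 < ε₀)
    (B11 A11 : Matrix (Fin nx) (Fin nx) ℝ) (B12 : Matrix (Fin nx) (Fin ny) ℝ)
    (B21 : Matrix (Fin ny) (Fin nx) ℝ) (B22 A22 : Matrix (Fin ny) (Fin ny) ℝ)
    (hB22 : IsUnit B22.det)
    (K11 : ℝ → Matrix (Fin nx) (Fin nx) ℝ) (K12 : ℝ → Matrix (Fin nx) (Fin ny) ℝ)
    (K21 : ℝ → Matrix (Fin ny) (Fin nx) ℝ) (K22 : ℝ → Matrix (Fin ny) (Fin ny) ℝ)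
    (hK11sym : ∀ ε ∈ Set.Ioo (0 : ℝ) ε₀, (K11 ε).IsSymm)
    (hK11inv : ∀ ε ∈ Set.Ioo (0 : ℝ) ε₀, IsUnit (K11 ε).det)
    (hK22sym : ∀ ε ∈ Set.Ioo (0 : ℝ) ε₀, (K22 ε).IsSymm)
    (hK21 : ∀ ε ∈ Set.Ioo (0 : ℝ) ε₀, K21 ε = (K12 ε)ᵀ)
    (hL1 : ∀ ε ∈ Set.Ioo (0 : ℝ) ε₀,
      B11 * K11 ε + B12 * K21 ε + K11 ε * B11ᵀ + K12 ε * B12ᵀ = -(A11 * A11ᵀ))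
    (hL2 : ∀ ε ∈ Set.Ioo (0 : ℝ) ε₀,
      B11 * K12 ε + B12 * K22 ε + ε⁻¹ • (K11 ε * B21ᵀ + K12 ε * B22ᵀ) = 0)
    (hL3 : ∀ ε ∈ Set.Ioo (0 : ℝ) ε₀,
      B21 * K12 ε + B22 * K22 ε + K21 ε * B21ᵀ + K22 ε * B22ᵀ = -(A22 * A22ᵀ))
    (K11₀ : Matrix (Fin nx) (Fin nx) ℝ) (K12₀ : Matrix (Fin nx) (Fin ny) ℝ)
    (K22₀ : Matrix (Fin ny) (Fin ny) ℝ)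
    (h11 : Tendsto K11 (nhdsWithin 0 (Set.Ioi 0)) (nhds K11₀))
    (h12 : Tendsto K12 (nhdsWithin 0 (Set.Ioi 0)) (nhds K12₀))
    (h22 : Tendsto K22 (nhdsWithin 0 (Set.Ioi 0)) (nhds K22₀))
    (hK11₀ : IsUnit K11₀.det) :
    ∃ S : Matrix (Fin ny) (Fin ny) ℝ,
      Tendsto (fun ε => K22 ε - K21 ε * (K11 ε)⁻¹ * K12 ε)
        (nhdsWithin 0 (Set.Ioi 0)) (nhds S) ∧
      B22 * S + S * B22ᵀ = -(A22 * A22ᵀ) := by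
  have hev : ∀ᶠ ε in 𝓝[>] (0 : ℝ), ε ∈ Set.Ioo (0 : ℝ) ε₀ := Ioo_mem_nhdsGT hε₀
  have h12T : Tendsto (fun ε => (K12 ε)ᵀ) (𝓝[>] 0) (𝓝 K12₀ᵀ) :=
    (continuous_id.matrix_transpose.tendsto _).comp h12
  have h21 : Tendsto K21 (𝓝[>] 0) (𝓝 K12₀ᵀ) :=
    h12T.congr' (hev.mono fun ε hε => (hK21 ε hε).symm)
  have hmul {a b c : ℕ} {f : ℝ → Matrix (Fin a) (Fin b) ℝ} {g : ℝ → Matrix (Fin b) (Fin c) ℝ}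
      {A : Matrix (Fin a) (Fin b) ℝ} {B : Matrix (Fin b) (Fin c) ℝ}
      (hf : Tendsto f (𝓝[>] 0) (𝓝 A)) (hg : Tendsto g (𝓝[>] 0) (𝓝 B)) :
      Tendsto (fun ε => f ε * g ε) (𝓝[>] 0) (𝓝 (A * B)) :=
    ((continuous_fst.matrix_mul continuous_snd).tendsto (A, B)).comp (hf.prodMk_nhds hg)
  have hsymm : K11₀.IsSymm :=
    tendsto_nhds_unique ((continuous_id.matrix_transpose.tendsto _).comp h11)
      (h11.congr' (hev.mono fun ε hε => (hK11sym ε hε).eq.symm))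
  have hoff : K11₀ * B21ᵀ + K12₀ * B22ᵀ = 0 := by
    have hlim := (hmul h11 (tendsto_const_nhds (x := B21ᵀ))).add
      (hmul h12 (tendsto_const_nhds (x := B22ᵀ)))
    have hε : Tendsto (fun ε : ℝ => ε) (𝓝[>] 0) (𝓝 0) := nhdsWithin_le_nhds
    have hzero := (hε.smul ((hmul (tendsto_const_nhds (x := B11)) h12).add
      (hmul (tendsto_const_nhds (x := B12)) h22))).neg
    rw [zero_smul, neg_zero] at hzero
    refine tendsto_nhds_unique hlim (hzero.congr' (hev.mono fun ε hε => ?_))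
    have h := eq_neg_of_add_eq_zero_left (hL2 ε hε)
    simp only [h, smul_neg, neg_neg, smul_inv_smul₀ hε.1.ne']
  have hdiag : B21 * K12₀ + B22 * K22₀ + K12₀ᵀ * B21ᵀ + K22₀ * B22ᵀ = -(A22 * A22ᵀ) := by
    have hlim := (((hmul (tendsto_const_nhds (x := B21)) h12).add
      (hmul (tendsto_const_nhds (x := B22)) h22)).add
      (hmul h21 (tendsto_const_nhds (x := B21ᵀ)))).add
      (hmul h22 (tendsto_const_nhds (x := B22ᵀ)))
    exact tendsto_nhds_unique hlim
      (tendsto_const_nhds.congr' (hev.mono fun ε hε => (hL3 ε hε).symm))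
  exact ⟨K22₀ - K12₀ᵀ * K11₀⁻¹ * K12₀,
    h22.sub (hmul (hmul h21 (Matrix.tendsto_inv_of_isUnit_det h11 hK11₀)) h12),
    Matrix.schur_complement_lyapunov hsymm hK11₀ hoff hdiag⟩
end

section
/- Let n ∈ ℕ, let B, A be real n×n matrices with A·Aᵀ ≠ 0, and let K be a symmetric positive-definite real n×n matrix satisfying the Lyapunov equation B·K + K·Bᵀ = −A·Aᵀ. Then 1/λmax(K) ≥ λmin(−(B + Bᵀ))/λmax(A·Aᵀ), where λmax(K) denotes the largest eigenvalue of K, λmin(−(B+Bᵀ)) the smallest eigenvalue of the symmetric matrix −(B + Bᵀ), and λmax(A·Aᵀ) the largest eigenvalue of A·Aᵀ. -/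
open Matrix

namespace Matrix.IsHermitian

variable {ι : Type*} [Fintype ι] [DecidableEq ι] {M : Matrix ι ι ℝ}

theorem dotProduct_mulVec_eq_sum_eigenvalues (hM : M.IsHermitian) (v : ι → ℝ) :
    v ⬝ᵥ M *ᵥ v =
      ∑ i, hM.eigenvalues i * (((hM.eigenvectorUnitary : Matrix ι ι ℝ)ᵀ *ᵥ v) i) ^ 2 := by
  conv_lhs => rw [hM.spectral_theorem, Unitary.conjStarAlgAut_apply, ← mulVec_mulVec,
    ← mulVec_mulVec, dotProduct_mulVec, ← mulVec_transpose, star_eq_conjTranspose,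
    conjTranspose_eq_transpose_of_trivial]
  simp only [dotProduct, mulVec_diagonal, Function.comp_apply, RCLike.ofReal_real_eq_id, id]
  exact Finset.sum_congr rfl fun i _ => by ring

theorem sum_sq_eigenvectorUnitary_transpose_mulVec (hM : M.IsHermitian) (v : ι → ℝ) :
    ∑ i, (((hM.eigenvectorUnitary : Matrix ι ι ℝ)ᵀ *ᵥ v) i) ^ 2 = v ⬝ᵥ v := by
  have hU : (hM.eigenvectorUnitary : Matrix ι ι ℝ) * (hM.eigenvectorUnitary : Matrix ι ι ℝ)ᵀ
      = 1 := by
    simpa [star_eq_conjTranspose] using Unitary.coe_mul_star_self hM.eigenvectorUnitary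
  calc _ = ((hM.eigenvectorUnitary : Matrix ι ι ℝ)ᵀ *ᵥ v) ⬝ᵥ
        ((hM.eigenvectorUnitary : Matrix ι ι ℝ)ᵀ *ᵥ v) := by simp only [dotProduct, sq]
    _ = v ⬝ᵥ v := by
      rw [dotProduct_mulVec, ← mulVec_transpose, transpose_transpose, mulVec_mulVec, hU,
        one_mulVec]

theorem iInf_eigenvalues_mul_le (hM : M.IsHermitian) (v : ι → ℝ) :
    (⨅ i, hM.eigenvalues i) * (v ⬝ᵥ v) ≤ v ⬝ᵥ M *ᵥ v := by
  rw [hM.dotProduct_mulVec_eq_sum_eigenvalues, ← hM.sum_sq_eigenvectorUnitary_transpose_mulVec,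
    Finset.mul_sum]
  gcongr with i
  exact ciInf_le (Set.finite_range _).bddBelow i

theorem le_iSup_eigenvalues_mul (hM : M.IsHermitian) (v : ι → ℝ) :
    v ⬝ᵥ M *ᵥ v ≤ (⨆ i, hM.eigenvalues i) * (v ⬝ᵥ v) := by
  rw [hM.dotProduct_mulVec_eq_sum_eigenvalues, ← hM.sum_sq_eigenvectorUnitary_transpose_mulVec,
    Finset.mul_sum]
  gcongr with i
  exact le_ciSup (Set.finite_range _).bddAbove i

end Matrix.IsHermitian

/-- The Lyapunov equation evaluated on an eigenvector of the symmetric matrix `K`. -/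
theorem Matrix.lyapunov_dotProduct_eigenvector {ι : Type*} [Fintype ι] {B K Q : Matrix ι ι ℝ}
    (hK : Kᵀ = K) (hLyap : B * K + K * Bᵀ = -Q) {v : ι → ℝ} {c : ℝ} (hv : K *ᵥ v = c • v) :
    c * (v ⬝ᵥ (-(B + Bᵀ)) *ᵥ v) = v ⬝ᵥ Q *ᵥ v := by
  have hv' : v ᵥ* K = c • v := by rw [← mulVec_transpose, hK, hv]
  have h := congrArg (fun N => v ⬝ᵥ N *ᵥ v) hLyap
  simp only [add_mulVec, neg_mulVec, dotProduct_add, dotProduct_neg, ← mulVec_mulVec, hv,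
    mulVec_smul, dotProduct_smul, smul_eq_mul] at h
  rw [dotProduct_mulVec v K, hv', smul_dotProduct, smul_eq_mul] at h
  simp only [neg_mulVec, add_mulVec, dotProduct_neg, dotProduct_add]
  linarith

/-- If K is symmetric positive definite and solves the Lyapunov equation
B·K + K·Bᵀ = −A·Aᵀ with A·Aᵀ ≠ 0, then
1/λmax(K) ≥ λmin(−(B+Bᵀ))/λmax(A·Aᵀ). -/
theorem lyapunov_spectral_bound {n : ℕ} (B A K : Matrix (Fin n) (Fin n) ℝ)
    (hAAne : A * Aᵀ ≠ 0)
    (hK : K.PosDef) (hLyap : B * K + K * Bᵀ = -(A * Aᵀ))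
    (hB : (-(B + Bᵀ)).IsHermitian) (hAA : (A * Aᵀ).IsHermitian) :
    (⨆ i, hK.1.eigenvalues i)⁻¹ ≥ (⨅ i, hB.eigenvalues i) / (⨆ i, hAA.eigenvalues i) := by
  have : Nonempty (Fin n) := not_isEmpty_iff.mp fun _ => hAAne (Subsingleton.elim _ _)
  obtain ⟨j, hj⟩ := exists_eq_ciSup_of_finite (f := hK.1.eigenvalues)
  have hKpos : 0 < ⨆ i, hK.1.eigenvalues i := hj ▸ hK.eigenvalues_pos j
  have hAnonneg : 0 ≤ ⨆ i, hAA.eigenvalues i := Real.iSup_nonneg fun i =>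
    (show (A * Aᵀ).PosSemidef by
      simpa using posSemidef_self_mul_conjTranspose A).eigenvalues_nonneg i
  have hKv := hK.1.mulVec_eigenvectorBasis j
  rw [hj] at hKv
  set v : Fin n → ℝ := ⇑(hK.1.eigenvectorBasis j)
  have hv : v ⬝ᵥ v = 1 := by
    have h := EuclideanSpace.inner_eq_star_dotProduct (𝕜 := ℝ) (hK.1.eigenvectorBasis j)
      (hK.1.eigenvectorBasis j)
    rw [real_inner_self_eq_norm_sq, hK.1.eigenvectorBasis.norm_eq_one, one_pow] at h
    simpa using h.symm
  have hquad := lyapunov_dotProduct_eigenvector (by simpa using hK.1.eq) hLyap hKv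
  have hlow := hB.iInf_eigenvalues_mul_le v
  have hup := hAA.le_iSup_eigenvalues_mul v
  rw [hv, mul_one] at hlow hup
  have hmul := (mul_le_mul_of_nonneg_left hlow hKpos.le).trans (hquad.trans_le hup)
  refine div_le_of_le_mul₀ hAnonneg (inv_nonneg.mpr hKpos.le) ?_
  rwa [inv_mul_eq_div, le_div_iff₀' hKpos]
end

section
/- Let p ≥ 0 and ε > 0. Set Bᵉ = [[−1, 1], [0, −1/ε]] and Dᵉ = diag(ε^p, 1/ε) (2×2 real matrices), and define the symmetric matrix Kᵉ with entries K11 = ε^p/2 + ε/(2(1+ε)), K12 = K21 = ε/(2(1+ε)), K22 = 1/2. Then Bᵉ·Kᵉ + Kᵉ·(Bᵉ)ᵀ = −Dᵉ, and the conditional-mean coefficient satisfies mᶜ(ε) := K21·K11⁻¹ = 1/(1 + ε^{p−1} + ε^p). Consequently, as ε → 0⁺: mᶜ(ε) → 1 if p > 1; mᶜ(ε) → 1/2 if p = 1; and mᶜ(ε) → 0 if 0 ≤ p < 1. -/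
open Matrix Filter Topology

/-- Drift matrix of dX = (−X+Y)dt + ε^{p/2}dW¹, dY = −(1/ε)Y dt + (1/√ε)dW². -/
noncomputable def pB (ε : ℝ) : Matrix (Fin 2) (Fin 2) ℝ :=
  !![-1, 1; 0, -1 / ε]

/-- Diffusion matrix diag(ε^p, 1/ε). -/
noncomputable def pD (p ε : ℝ) : Matrix (Fin 2) (Fin 2) ℝ :=
  !![ε ^ p, 0; 0, 1 / ε]

/-- Invariant covariance Kᵉ for the p-scaled system. -/
noncomputable def pK (p ε : ℝ) : Matrix (Fin 2) (Fin 2) ℝ :=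
  !![ε ^ p / 2 + ε / (2 * (1 + ε)), ε / (2 * (1 + ε));
     ε / (2 * (1 + ε)), 1 / 2]

/-- Conditional-mean coefficient mᶜ(ε) = K21·K11⁻¹. -/
noncomputable def pMc (p ε : ℝ) : ℝ :=
  (ε / (2 * (1 + ε))) * (ε ^ p / 2 + ε / (2 * (1 + ε)))⁻¹

theorem pB_mul_pK_add_pK_mul_transpose_pB (p : ℝ) {ε : ℝ} (hε : 0 < ε) :
    pB ε * pK p ε + pK p ε * (pB ε)ᵀ = -(pD p ε) := by
  have h : 1 + ε ≠ 0 := by positivity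
  ext i j
  fin_cases i <;> fin_cases j <;>
    simp [pB, pK, pD, vecMul, dotProduct] <;> field_simp <;> ring

theorem pMc_eq (p : ℝ) {ε : ℝ} (hε : 0 < ε) :
    pMc p ε = 1 / (1 + ε ^ (p - 1) + ε ^ p) := by
  have hpow : ε ^ p = ε ^ (p - 1) * ε := by
    rw [Real.rpow_sub_one hε.ne', div_mul_cancel₀ _ hε.ne']
  have hpos : 0 < ε ^ (p - 1) := Real.rpow_pos_of_pos hε _
  rw [pMc, hpow]
  field_simp
  ring

theorem tendsto_rpow_nhdsGT_zero {q : ℝ} (hq : 0 < q) :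
    Tendsto (fun ε : ℝ => ε ^ q) (𝓝[>] 0) (𝓝 0) := by
  have h := (Real.continuousAt_rpow_const 0 q (Or.inr hq.le)).tendsto
  rw [Real.zero_rpow hq.ne'] at h
  exact h.mono_left nhdsWithin_le_nhds

theorem pMc_eventuallyEq (p : ℝ) :
    (fun ε : ℝ => 1 / (1 + ε ^ (p - 1) + ε ^ p)) =ᶠ[𝓝[>] 0] fun ε => pMc p ε := by
  filter_upwards [self_mem_nhdsWithin] with ε hε
  exact (pMc_eq p hε).symm

/-- Kᵉ solves Bᵉ·Kᵉ + Kᵉ·(Bᵉ)ᵀ = −Dᵉ, the conditional-mean coefficient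
is mᶜ(ε) = 1/(1 + ε^{p−1} + ε^p), and as ε → 0⁺: mᶜ(ε) → 1 if p > 1, mᶜ(ε) → 1/2 if
p = 1, and mᶜ(ε) → 0 if 0 ≤ p < 1. -/
theorem p_scaling_conditional_mean (p : ℝ) (hp : 0 ≤ p) :
    (∀ ε : ℝ, 0 < ε →
      pB ε * pK p ε + pK p ε * (pB ε)ᵀ = -(pD p ε)) ∧
    (∀ ε : ℝ, 0 < ε →
      pMc p ε = 1 / (1 + ε ^ (p - 1) + ε ^ p)) ∧
    (1 < p → Tendsto (fun ε : ℝ => pMc p ε) (nhdsWithin 0 (Set.Ioi 0)) (nhds 1)) ∧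
    (p = 1 → Tendsto (fun ε : ℝ => pMc p ε) (nhdsWithin 0 (Set.Ioi 0)) (nhds (1 / 2))) ∧
    (p < 1 → Tendsto (fun ε : ℝ => pMc p ε) (nhdsWithin 0 (Set.Ioi 0)) (nhds 0)) := by
  refine ⟨fun ε hε => pB_mul_pK_add_pK_mul_transpose_pB p hε, fun ε hε => pMc_eq p hε,
    fun h => ?_, fun h => ?_, fun h => ?_⟩ <;> refine Tendsto.congr' (pMc_eventuallyEq p) ?_
  · have h₁ := tendsto_rpow_nhdsGT_zero (sub_pos.mpr h)
    have h₂ := tendsto_rpow_nhdsGT_zero (zero_lt_one.trans h)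
    simpa using ((h₁.const_add 1).add h₂).inv₀ (by norm_num)
  · subst h
    have h₂ := tendsto_rpow_nhdsGT_zero zero_lt_one
    have h₃ := (h₂.const_add (1 + 1)).inv₀ (by norm_num)
    norm_num at h₃ ⊢
    exact h₃
  · have h₁ : Tendsto (fun ε : ℝ => ε ^ (p - 1)) (𝓝[>] 0) atTop :=
      tendsto_rpow_neg_nhdsGT_zero (sub_neg.mpr h)
    simp only [one_div]
    refine (tendsto_atTop_mono' _ ?_ h₁).inv_tendsto_atTop
    filter_upwards [self_mem_nhdsWithin] with ε hε
    have : 0 < ε ^ p := Real.rpow_pos_of_pos hε p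
    linarith
end
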